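/- Consider the implicit L2-1_σ difference scheme for the 2D time fractional reaction-diffusion equation with homogeneous boundary conditions, and let K > 0. There exists a constant C₃ > 0, depending only on α, T, σ and K (but not on N_x, N_y, M, h_x, h_y, τ), with the following property: if the grid function ξ = (ξ_{i l}^j) satisfies ξ_{i l}^0 = 0 for all (i,l), ξ vanishes on the spatial boundary for every j, the convention ξ_{i l}^{-1} = ξ_{i l}^0, and the error equation δ_t̂ ξ_{i l}^j + Δ^α ξ_{i l}^j = σ(Λ̃^j ξ^{j+1})_{i l} + (1-σ)(Λ̃^j ξ^j)_{i l} + R̃_{i l}^{j+σ} for all interior (i,l), 0 ≤ j ≤ M-1, where the residuals satisfy ‖R̃^{j+σ}‖_{2D} ≤ K (τ² + h_x² + h_y²) for all 0 ≤ j ≤ M-1, then ‖ξ^j‖_{2D} ≤ C₃ (τ² + h_x² + h_y²) for all 0 ≤ j ≤ M. In particular the scheme converges with order O(τ² + h_x² + h_y²) in the discrete L₂ norm. -/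

import Mathlib

/-- `a_l^{(α,σ)}`: `a_0 = σ^{1-α}`, `a_l = (l+σ)^{1-α} - (l-1+σ)^{1-α}` for `l ≥ 1`. -/
noncomputable def aC (α σ : ℝ) (l : ℕ) : ℝ :=
  if l = 0 then σ ^ (1 - α)
  else ((l : ℝ) + σ) ^ (1 - α) - ((l : ℝ) - 1 + σ) ^ (1 - α)

/-- `b_l^{(α,σ)}` for `l ≥ 1`. -/
noncomputable def bC (α σ : ℝ) (l : ℕ) : ℝ :=
  (((l : ℝ) + σ) ^ (2 - α) - ((l : ℝ) - 1 + σ) ^ (2 - α)) / (2 - α)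
    - (((l : ℝ) + σ) ^ (1 - α) - ((l : ℝ) - 1 + σ) ^ (1 - α)) / 2

/-- `c_s^{(α,σ)}` with top index `j`. -/
noncomputable def cC (α σ : ℝ) (j s : ℕ) : ℝ :=
  if j = 0 then aC α σ 0
  else if s = 0 then aC α σ 0 + bC α σ 1
  else if s = j then aC α σ j - bC α σ j
  else aC α σ s + bC α σ (s + 1) - bC α σ s

/-- Drift approximation `δ_t̂ v^j = (1/(2τ))[(2σ+1)v^{j+1} - 4σ v^j + (2σ-1)v^{j-1}]`
(natural subtraction realizes the convention `v^{-1} = v^0`). -/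
noncomputable def driftD (σ τ : ℝ) (v : ℕ → ℝ) (j : ℕ) : ℝ :=
  (1 / (2 * τ)) * ((2 * σ + 1) * v (j + 1) - 4 * σ * v j + (2 * σ - 1) * v (j - 1))

/-- Discrete Caputo (L2-1_σ) operator
`Δ^α v^j = (τ^{-α}/Γ(2-α)) Σ_{s=0}^{j} c_{j-s}^{(α,σ)}(v^{s+1} - v^s)`. -/
noncomputable def fracD (α σ τ : ℝ) (v : ℕ → ℝ) (j : ℕ) : ℝ :=
  (τ ^ (-α) / Real.Gamma (2 - α)) *
    ∑ s ∈ Finset.range (j + 1), cC α σ j (j - s) * (v (s + 1) - v s)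

/-- 2D discrete variable-coefficient diffusion-reaction operator `Λ̃` at time `t`. -/
noncomputable def lam2D (d k q : ℝ → ℝ → ℝ → ℝ) (hx hy t : ℝ)
    (V : ℕ → ℕ → ℝ) (i l : ℕ) : ℝ :=
  (1 / hx ^ 2) * (d ((i : ℝ) * hx + hx / 2) ((l : ℝ) * hy) t * (V (i + 1) l - V i l)
      - d ((i : ℝ) * hx - hx / 2) ((l : ℝ) * hy) t * (V i l - V (i - 1) l))
    + (1 / hy ^ 2) * (k ((i : ℝ) * hx) ((l : ℝ) * hy + hy / 2) t * (V i (l + 1) - V i l)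
      - k ((i : ℝ) * hx) ((l : ℝ) * hy - hy / 2) t * (V i l - V i (l - 1)))
    - q ((i : ℝ) * hx) ((l : ℝ) * hy) t * V i l

/-- 2D discrete squared `L₂` norm
`‖V‖²_{2D} = hx hy Σ_{i=1}^{Nx-1} Σ_{l=1}^{Ny-1} V_{il}²`. -/
noncomputable def nrm2D (hx hy : ℝ) (Nx Ny : ℕ) (V : ℕ → ℕ → ℝ) : ℝ :=
  hx * hy * ∑ i ∈ Finset.Icc 1 (Nx - 1), ∑ l ∈ Finset.Icc 1 (Ny - 1), (V i l) ^ 2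

/-- The coefficients `c_s` without the correction for the top index. -/
noncomputable def kernelC (α σ : ℝ) (s : ℕ) : ℝ :=
  if s = 0 then aC α σ 0 + bC α σ 1 else aC α σ s + bC α σ (s + 1) - bC α σ s

theorem cC_eq_kernelC_of_lt {α σ : ℝ} {j s : ℕ} (h : s < j) : cC α σ j s = kernelC α σ s := by
  unfold cC kernelC
  rw [if_neg (by omega : j ≠ 0), if_neg h.ne]

theorem cC_self (α σ : ℝ) (j : ℕ) : cC α σ j j = kernelC α σ j - bC α σ (j + 1) := by
  unfold cC kernelC
  rcases eq_or_ne j 0 with rfl | h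
  · simp
  · simp only [if_neg h, if_true]
    ring

theorem rpow_add_inv_le {p x : ℝ} (hp0 : 0 ≤ p) (hp1 : p ≤ 1) (hx : 0 < x) :
    (x + 1) ^ p ≤ x ^ p * (1 + p / x) := by
  have h : x + 1 = x * (1 + 1 / x) := by field_simp
  rw [h, Real.mul_rpow hx.le (by positivity)]
  gcongr
  have := rpow_one_add_le_one_add_mul_self (s := 1 / x)
    (by have : 0 < 1 / x := by positivity
        linarith) hp0 hp1
  calc _ ≤ _ := this
    _ = _ := by ring

theorem rpow_midpoint_concave {p x : ℝ} (hp0 : 0 ≤ p) (hp1 : p ≤ 1) (hx : 1 ≤ x) :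
    (x + 1) ^ p + (x - 1) ^ p ≤ 2 * x ^ p := by
  have h := (Real.concaveOn_rpow hp0 hp1).2 (show x + 1 ∈ Set.Ici 0 by simp; linarith)
    (show x - 1 ∈ Set.Ici 0 by simp; linarith)
    (show (0 : ℝ) ≤ 1 / 2 by norm_num) (show (0 : ℝ) ≤ 1 / 2 by norm_num) (by norm_num)
  simp only [smul_eq_mul] at h
  rw [show 1 / 2 * (x + 1) + 1 / 2 * (x - 1) = x by ring] at h
  linarith

theorem rpow_midpoint_convex {p x : ℝ} (hp1 : 1 ≤ p) (hx : 1 ≤ x) :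
    2 * x ^ p ≤ (x + 1) ^ p + (x - 1) ^ p := by
  have h := (convexOn_rpow hp1).2 (show x + 1 ∈ Set.Ici 0 by simp; linarith)
    (show x - 1 ∈ Set.Ici 0 by simp; linarith)
    (show (0 : ℝ) ≤ 1 / 2 by norm_num) (show (0 : ℝ) ≤ 1 / 2 by norm_num) (by norm_num)
  simp only [smul_eq_mul] at h
  rw [show 1 / 2 * (x + 1) + 1 / 2 * (x - 1) = x by ring] at h
  linarith

theorem rpow_midpoint_convex_of_nonpos {p x : ℝ} (hp : p ≤ 0) (hx : 1 < x) :
    2 * x ^ p ≤ (x + 1) ^ p + (x - 1) ^ p := by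
  have h1 : 0 < x - 1 := by linarith
  have hprod : x ^ p * x ^ p ≤ (x + 1) ^ p * (x - 1) ^ p := by
    rw [← Real.mul_rpow (by linarith) (by linarith), ← Real.mul_rpow (by linarith) (by linarith)]
    exact Real.rpow_le_rpow_of_nonpos (by nlinarith) (by nlinarith) hp
  have hu : 0 < (x + 1) ^ p := Real.rpow_pos_of_pos (by linarith) _
  have hw : 0 < (x - 1) ^ p := Real.rpow_pos_of_pos h1 _
  refine abs_le_of_sq_le_sq' ?_ (by positivity) |>.2
  nlinarith [sq_nonneg ((x + 1) ^ p - (x - 1) ^ p)]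

/-- A function of a real variable interpolating `kernelC` at the points `s + σ`, `s ≥ 1`. -/
noncomputable def kernelFun (p σ x : ℝ) : ℝ :=
  x ^ p - (x - 1) ^ p
    + (((x + 1) ^ (p + 1) - σ * (x + 1) ^ p) - 2 * (x ^ (p + 1) - σ * x ^ p)
      + ((x - 1) ^ (p + 1) - σ * (x - 1) ^ p)) / (2 * σ)

theorem kernelFun_pos {p σ x : ℝ} (hp0 : 0 < p) (hp1 : p ≤ 1) (hσ : 0 < σ) (hx : 1 ≤ x) :
    0 < kernelFun p σ x := by
  unfold kernelFun
  have h1 : (x - 1) ^ p < x ^ p := Real.rpow_lt_rpow (by linarith) (by linarith) hp0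
  have h2 := rpow_midpoint_concave hp0.le hp1 hx
  have h3 := rpow_midpoint_convex (p := p + 1) (by linarith) hx
  have : 0 ≤ (((x + 1) ^ (p + 1) - σ * (x + 1) ^ p) - 2 * (x ^ (p + 1) - σ * x ^ p)
      + ((x - 1) ^ (p + 1) - σ * (x - 1) ^ p)) / (2 * σ) := by
    apply div_nonneg _ (by positivity)
    nlinarith
  linarith

theorem kernelFun_antitoneOn {p σ : ℝ} (hp0 : 0 < p) (hp1 : p ≤ 1) (hσ : 0 < σ) :
    AntitoneOn (kernelFun p σ) (Set.Ioi 1) := by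
  have hd : ∀ x ∈ Set.Ioi (1 : ℝ), HasDerivAt (kernelFun p σ)
      (p * x ^ (p - 1) - p * (x - 1) ^ (p - 1)
        + ((((p + 1) * (x + 1) ^ p) - σ * (p * (x + 1) ^ (p - 1)))
          - 2 * ((p + 1) * x ^ p - σ * (p * x ^ (p - 1)))
          + ((p + 1) * (x - 1) ^ p - σ * (p * (x - 1) ^ (p - 1)))) / (2 * σ)) x := by
    intro x hx
    have hx : 1 < x := hx
    have e0 (q : ℝ) : HasDerivAt (fun y : ℝ => y ^ q) (q * x ^ (q - 1)) x :=
      Real.hasDerivAt_rpow_const (Or.inl (by linarith))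
    have e1 (q : ℝ) : HasDerivAt (fun y : ℝ => (y + 1) ^ q) (q * (x + 1) ^ (q - 1)) x := by
      simpa using ((hasDerivAt_id x).add_const 1).rpow_const (p := q)
        (Or.inl (by simp only [id]; linarith))
    have em (q : ℝ) : HasDerivAt (fun y : ℝ => (y - 1) ^ q) (q * (x - 1) ^ (q - 1)) x := by
      simpa using ((hasDerivAt_id x).sub_const 1).rpow_const (p := q)
        (Or.inl (by simp only [id]; linarith))
    have := ((e0 p).sub (em p)).add (((((e1 (p + 1)).sub ((e1 p).const_mul σ)).sub
      (((e0 (p + 1)).sub ((e0 p).const_mul σ)).const_mul 2)).add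
      ((em (p + 1)).sub ((em p).const_mul σ))).div_const (2 * σ))
    simp only [add_sub_cancel_right] at this
    exact this
  apply antitoneOn_of_deriv_nonpos (convex_Ioi 1)
    (fun x hx => (hd x hx).continuousAt.continuousWithinAt)
  · rw [interior_Ioi]
    exact fun x hx => (hd x hx).differentiableAt.differentiableWithinAt
  · rw [interior_Ioi]
    intro x hx
    rw [(hd x hx).deriv]
    have hx : 1 < x := hx
    have h1 : x ^ (p - 1) ≤ (x - 1) ^ (p - 1) :=
      Real.rpow_le_rpow_of_nonpos (by linarith) (by linarith) (by linarith)
    have h2 := rpow_midpoint_concave hp0.le hp1 hx.le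
    have h3 := rpow_midpoint_convex_of_nonpos (p := p - 1) (by linarith) hx
    have h4 : p * x ^ (p - 1) ≤ p * (x - 1) ^ (p - 1) := by gcongr
    have h5 : ((((p + 1) * (x + 1) ^ p) - σ * (p * (x + 1) ^ (p - 1)))
          - 2 * ((p + 1) * x ^ p - σ * (p * x ^ (p - 1)))
          + ((p + 1) * (x - 1) ^ p - σ * (p * (x - 1) ^ (p - 1)))) / (2 * σ) ≤ 0 := by
      apply div_nonpos_of_nonpos_of_nonneg _ (by positivity)
      nlinarith [mul_le_mul_of_nonneg_left h2 (by linarith : 0 ≤ p + 1),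
        mul_le_mul_of_nonneg_left h3 (by positivity : 0 ≤ σ * p)]
    linarith

section Coefficients

variable {α σ : ℝ}

theorem bC_succ_eq (hα : 0 < α ∧ α < 1) (hσ : σ = 1 - α / 2) (l : ℕ) :
    bC α σ (l + 1) = ((l + 1) * ((l : ℝ) + σ + 1) ^ (1 - α) - l * ((l : ℝ) + σ) ^ (1 - α))
      / (2 * σ) := by
  obtain ⟨h0, h1⟩ := hα
  have hs : 0 < σ := by linarith
  have hl : (0 : ℝ) ≤ l := l.cast_nonneg
  unfold bC
  push_cast
  rw [show (l : ℝ) + 1 + σ = l + σ + 1 by ring, show (l : ℝ) + 1 - 1 + σ = l + σ by ring,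
    show 2 - α = (1 - α) + 1 by ring, Real.rpow_add_one (by positivity),
    Real.rpow_add_one (by positivity), show 1 - α + 1 = 2 * σ by rw [hσ]; ring]
  field_simp
  ring

theorem kernelC_zero (hα : 0 < α ∧ α < 1) (hσ : σ = 1 - α / 2) :
    kernelC α σ 0 = σ ^ (1 - α) + (σ + 1) ^ (1 - α) / (2 * σ) := by
  have := bC_succ_eq hα hσ 0
  simp only [kernelC, aC, if_true]
  norm_num at this
  rw [this]

theorem kernelC_succ (hα : 0 < α ∧ α < 1) (hσ : σ = 1 - α / 2) (s : ℕ) :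
    kernelC α σ (s + 1) = kernelFun (1 - α) σ (s + 1 + σ) := by
  have hs : 0 < σ := by linarith [hα.2]
  have hl : (0 : ℝ) ≤ s := s.cast_nonneg
  have e1 := bC_succ_eq hα hσ s
  have e2 := bC_succ_eq hα hσ (s + 1)
  push_cast at e2
  simp only [kernelC, aC, if_neg s.succ_ne_zero]
  rw [e1, e2, kernelFun]
  push_cast
  rw [show (s : ℝ) + 1 + σ - 1 = s + σ by ring, show (s : ℝ) + 1 - 1 + σ = s + σ by ring,
    show (s : ℝ) + σ + 1 = s + 1 + σ by ring, Real.rpow_add_one (by positivity),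
    Real.rpow_add_one (by positivity), Real.rpow_add_one (by positivity)]
  ring

theorem kernelC_pos (hα : 0 < α ∧ α < 1) (hσ : σ = 1 - α / 2) (s : ℕ) : 0 < kernelC α σ s := by
  have hs : 0 < σ := by linarith [hα.2]
  cases s with
  | zero =>
    rw [kernelC_zero hα hσ]
    positivity
  | succ s =>
    rw [kernelC_succ hα hσ]
    have hl : (0 : ℝ) ≤ s := s.cast_nonneg
    exact kernelFun_pos (by linarith [hα.2]) (by linarith [hα.1]) hs (by linarith)

theorem mul_kernelC_one_le (hα : 0 < α ∧ α < 1) (hσ : σ = 1 - α / 2) :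
    σ * kernelC α σ 1 ≤ (2 * σ - 1) * kernelC α σ 0 := by
  obtain ⟨h0, h1⟩ := hα
  have hs : 0 < σ := by linarith
  rw [kernelC_succ ⟨h0, h1⟩ hσ 0, kernelC_zero ⟨h0, h1⟩ hσ, kernelFun]
  have hb1 := rpow_add_inv_le (p := 1 - α) (x := σ) (by linarith) (by linarith) hs
  have hb2 := rpow_add_inv_le (p := 1 - α) (x := σ + 1) (by linarith) (by linarith) (by linarith)
  rw [Nat.cast_zero, show (0 : ℝ) + 1 + σ = σ + 1 by ring, show σ + 1 - 1 = σ by ring,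
    Real.rpow_add_one (by positivity), Real.rpow_add_one (by positivity),
    Real.rpow_add_one (by positivity)]
  have hp : 1 - α = 2 * σ - 1 := by linarith
  rw [hp] at hb1 hb2 ⊢
  set f0 := σ ^ (2 * σ - 1)
  set f1 := (σ + 1) ^ (2 * σ - 1)
  set f2 := (σ + 1 + 1) ^ (2 * σ - 1)
  have hf1p : 0 < f1 := by positivity
  have k1 : σ * (f1 - f0) ≤ (2 * σ - 1) * f0 := by
    have : σ * f1 ≤ σ * (f0 * (1 + (2 * σ - 1) / σ)) := by gcongr
    have e : σ * (f0 * (1 + (2 * σ - 1) / σ)) = σ * f0 + (2 * σ - 1) * f0 := by field_simp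
    linarith
  have k2 : f2 * (2 * σ) ≤ f1 * (4 * σ - 1) := by
    have : (2 * σ - 1) / (σ + 1) ≤ (2 * σ - 1) / (2 * σ) := by
      apply div_le_div_of_nonneg_left <;> linarith
    have : f2 ≤ f1 * (1 + (2 * σ - 1) / (2 * σ)) := hb2.trans (by gcongr)
    have := mul_le_mul_of_nonneg_right this (by linarith : 0 ≤ 2 * σ)
    have e : f1 * (1 + (2 * σ - 1) / (2 * σ)) * (2 * σ) = f1 * (4 * σ - 1) := by
      field_simp; ring
    linarith
  field_simp
  nlinarith

theorem kernelC_antitone (hα : 0 < α ∧ α < 1) (hσ : σ = 1 - α / 2) : Antitone (kernelC α σ) := by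
  apply antitone_nat_of_succ_le
  intro s
  have hs : 0 < σ := by linarith [hα.2]
  cases s with
  | zero =>
    have h := mul_kernelC_one_le hα hσ
    have h0 := kernelC_pos hα hσ 0
    have : 2 * σ - 1 ≤ σ := by linarith [hα.1]
    simp only [zero_add]
    nlinarith
  | succ s =>
    rw [kernelC_succ hα hσ, kernelC_succ hα hσ]
    push_cast
    have hl : (0 : ℝ) ≤ s := s.cast_nonneg
    exact kernelFun_antitoneOn (by linarith [hα.2]) (by linarith [hα.1]) hs
      (by simp; linarith) (by simp; linarith) (by linarith)

theorem bC_succ_nonneg (hα : 0 < α ∧ α < 1) (hσ : σ = 1 - α / 2) (l : ℕ) :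
    0 ≤ bC α σ (l + 1) := by
  have hs : 0 < σ := by linarith [hα.2]
  have hl : (0 : ℝ) ≤ l := l.cast_nonneg
  rw [bC_succ_eq hα hσ]
  apply div_nonneg _ (by positivity)
  have : ((l : ℝ) + σ) ^ (1 - α) ≤ ((l : ℝ) + σ + 1) ^ (1 - α) := by
    apply Real.rpow_le_rpow <;> linarith [hα.2]
  have h0 : 0 ≤ ((l : ℝ) + σ) ^ (1 - α) := by positivity
  nlinarith

theorem bC_succ_le (hα : 0 < α ∧ α < 1) (hσ : σ = 1 - α / 2) (l : ℕ) :
    bC α σ (l + 1) ≤ 3 * ((l : ℝ) + 1) ^ (1 - α) := by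
  have hs : 0 < σ := by linarith [hα.2]
  have hl : (0 : ℝ) ≤ l := l.cast_nonneg
  have h0 : 0 ≤ ((l : ℝ) + σ) ^ (1 - α) := by positivity
  have hf : ((l : ℝ) + σ) ^ (1 - α) ≤ ((l : ℝ) + 1) ^ (1 - α) := by
    apply Real.rpow_le_rpow <;> linarith [hα.1, hα.2]
  have hb := rpow_add_inv_le (p := 1 - α) (x := l + σ) (by linarith [hα.2]) (by linarith [hα.1])
    (by linarith)
  have hq : ((l : ℝ) + 1) * ((1 - α) / (l + σ)) ≤ 2 := by
    rw [mul_div_assoc', div_le_iff₀ (by linarith)]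
    nlinarith [hα.1, hα.2]
  rw [bC_succ_eq hα hσ, div_le_iff₀ (by positivity)]
  have h1 : ((l : ℝ) + 1) * ((l : ℝ) + σ + 1) ^ (1 - α) - l * ((l : ℝ) + σ) ^ (1 - α)
      ≤ 3 * ((l : ℝ) + σ) ^ (1 - α) := by
    have := mul_le_mul_of_nonneg_left hb (by linarith : 0 ≤ (l : ℝ) + 1)
    nlinarith
  have h2 : 0 ≤ ((l : ℝ) + 1) ^ (1 - α) := by positivity
  nlinarith [hα.2]

end Coefficients

open Finset in
theorem sq_sum_div_le_sum_kernel (e v : ℕ → ℝ) (n : ℕ) (hpos : ∀ s ≤ n, 0 < e s)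
    (hmono : ∀ s < n, e s ≤ e (s + 1)) :
    (∑ s ∈ range (n + 1), e s * (v (s + 1) - v s)) ^ 2 / (2 * e n)
      ≤ ∑ s ∈ range (n + 1), e s * (v (s + 1) - v s) * (v (n + 1) - (v (s + 1) + v s) / 2) := by
  induction n with
  | zero =>
    have := hpos 0 le_rfl
    apply le_of_eq
    simp only [zero_add, sum_range_one]
    field_simp
    ring
  | succ n ih =>
    have ih := ih (fun s hs => hpos s (by omega)) (fun s hs => hmono s (by omega))
    have h0 := hpos n (by omega)
    have h1 := hpos (n + 1) le_rfl
    have hm := hmono n (by omega)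
    have key : ∑ s ∈ range (n + 1),
          e s * (v (s + 1) - v s) * (v (n + 1 + 1) - (v (s + 1) + v s) / 2)
        = ∑ s ∈ range (n + 1), e s * (v (s + 1) - v s) * (v (n + 1) - (v (s + 1) + v s) / 2)
          + (∑ s ∈ range (n + 1), e s * (v (s + 1) - v s)) * (v (n + 1 + 1) - v (n + 1)) := by
      rw [sum_mul, ← sum_add_distrib]
      exact sum_congr rfl fun s _ => by ring
    rw [sum_range_succ _ (n + 1), sum_range_succ _ (n + 1), key]
    set P := ∑ s ∈ range (n + 1), e s * (v (s + 1) - v s)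
    set d := v (n + 1 + 1) - v (n + 1) with hd
    have hP : P ^ 2 / (2 * e (n + 1)) ≤ P ^ 2 / (2 * e n) := by gcongr
    have he : (P + e (n + 1) * d) ^ 2 / (2 * e (n + 1))
        = P ^ 2 / (2 * e (n + 1)) + P * d + e (n + 1) * d * (d / 2) := by
      field_simp
      ring
    have hv : v (n + 1 + 1) - (v (n + 1 + 1) + v (n + 1)) / 2 = d / 2 := by rw [hd]; ring
    rw [he, hv]
    linarith

open Finset in
/-- Discrete coercivity: the weighted average of two consecutive values, tested against a
difference operator with monotone positive weights, dominates half the operator applied to the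
square. -/
theorem half_sum_kernel_sq_le (e v : ℕ → ℝ) (σ : ℝ) (hσ0 : 1 / 2 ≤ σ) (hσ1 : σ ≤ 1) (j : ℕ)
    (hpos : ∀ s ≤ j, 0 < e s) (hmono : ∀ s < j, e s ≤ e (s + 1))
    (hlast : ∀ s, s + 1 = j → σ * e s ≤ (2 * σ - 1) * e (s + 1)) :
    1 / 2 * ∑ s ∈ range (j + 1), e s * (v (s + 1) ^ 2 - v s ^ 2)
      ≤ (∑ s ∈ range (j + 1), e s * (v (s + 1) - v s)) * (σ * v (j + 1) + (1 - σ) * v j) := by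
  have key : (∑ s ∈ range (j + 1), e s * (v (s + 1) - v s)) * (σ * v (j + 1) + (1 - σ) * v j)
        - 1 / 2 * ∑ s ∈ range (j + 1), e s * (v (s + 1) ^ 2 - v s ^ 2)
      = ∑ s ∈ range (j + 1), e s * (v (s + 1) - v s) * (v (j + 1) - (v (s + 1) + v s) / 2)
        - (1 - σ) * (v (j + 1) - v j) * ∑ s ∈ range (j + 1), e s * (v (s + 1) - v s) := by
    rw [sum_mul, mul_sum, mul_sum, ← sum_sub_distrib, ← sum_sub_distrib]
    exact sum_congr rfl fun s _ => by ring
  suffices h : (1 - σ) * (v (j + 1) - v j) * ∑ s ∈ range (j + 1), e s * (v (s + 1) - v s)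
      ≤ ∑ s ∈ range (j + 1), e s * (v (s + 1) - v s) * (v (j + 1) - (v (s + 1) + v s) / 2) by
    linarith
  cases j with
  | zero =>
    have := hpos 0 le_rfl
    simp only [zero_add, sum_range_one]
    nlinarith [mul_nonneg (mul_nonneg this.le (sq_nonneg (v 1 - v 0)))
      (by linarith : 0 ≤ σ - 1 / 2)]
  | succ n =>
    have hform := sq_sum_div_le_sum_kernel e v n (fun s hs => hpos s (by omega))
      (fun s hs => hmono s (by omega))
    have h0 := hpos n (by omega)
    have h1 := hpos (n + 1) le_rfl
    have hl := hlast n rfl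
    have key : ∑ s ∈ range (n + 1),
          e s * (v (s + 1) - v s) * (v (n + 1 + 1) - (v (s + 1) + v s) / 2)
        = ∑ s ∈ range (n + 1), e s * (v (s + 1) - v s) * (v (n + 1) - (v (s + 1) + v s) / 2)
          + (∑ s ∈ range (n + 1), e s * (v (s + 1) - v s)) * (v (n + 1 + 1) - v (n + 1)) := by
      rw [sum_mul, ← sum_add_distrib]
      exact sum_congr rfl fun s _ => by ring
    rw [sum_range_succ _ (n + 1), sum_range_succ _ (n + 1), key]
    set P := ∑ s ∈ range (n + 1), e s * (v (s + 1) - v s)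
    set d := v (n + 1 + 1) - v (n + 1) with hd
    have hv : v (n + 1 + 1) - (v (n + 1 + 1) + v (n + 1)) / 2 = d / 2 := by rw [hd]; ring
    rw [hv]
    have hquad : 0 ≤ P ^ 2 / (2 * e n) + σ * (P * d) + (2 * σ - 1) / 2 * e (n + 1) * d ^ 2 := by
      have hsq : P ^ 2 / (2 * e n) + σ * (P * d) + σ / 2 * e n * d ^ 2
          = (P + σ * e n * d) ^ 2 / (2 * e n) + σ * (1 - σ) * e n * d ^ 2 / 2 := by
        field_simp
        ring
      have hnn : 0 ≤ (P + σ * e n * d) ^ 2 / (2 * e n) + σ * (1 - σ) * e n * d ^ 2 / 2 := by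
        have : 0 ≤ 1 - σ := by linarith
        positivity
      nlinarith [mul_le_mul_of_nonneg_right hl (sq_nonneg d)]
    linarith

open Finset in
/-- A double sum over a convolution kernel collapses to a single one. -/
theorem sum_convolution_diff (c V : ℕ → ℝ) (hV : V 0 = 0) (n : ℕ) :
    ∑ j ∈ range n, ∑ s ∈ range (j + 1), c (j - s) * (V (s + 1) - V s)
      = ∑ s ∈ range n, c (n - 1 - s) * V (s + 1) := by
  have hrow (j : ℕ) : ∑ s ∈ range (j + 1), c (j - s) * (V (s + 1) - V s)
      = ∑ s ∈ range (j + 1), c (j - s) * V (s + 1) - ∑ s ∈ range j, c (j - 1 - s) * V (s + 1) := by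
    have h : ∑ s ∈ range (j + 1), c (j - s) * V s = ∑ s ∈ range j, c (j - 1 - s) * V (s + 1) := by
      rw [sum_range_succ', hV, mul_zero, add_zero]
      exact sum_congr rfl fun s _ => by rw [show j - (s + 1) = j - 1 - s by omega]
    rw [← h, ← sum_sub_distrib]
    exact sum_congr rfl fun s _ => by ring
  induction n with
  | zero => simp
  | succ n ih =>
    rw [sum_range_succ, ih, hrow]
    simp

/-- The energy controlled by the drift approximation. -/
noncomputable def driftEnergy (σ : ℝ) (v : ℕ → ℝ) (n : ℕ) : ℝ :=
  (2 * σ + 1) * v n ^ 2 - (2 * σ - 1) * v (n - 1) ^ 2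
    + (2 * σ ^ 2 + σ - 1) * (v n - v (n - 1)) ^ 2

theorem driftEnergy_sub_le {σ τ : ℝ} (hσ : 1 / 2 ≤ σ) (hτ : 0 < τ) (v : ℕ → ℝ) (j : ℕ) :
    1 / (4 * τ) * (driftEnergy σ v (j + 1) - driftEnergy σ v j)
      ≤ driftD σ τ v j * (σ * v (j + 1) + (1 - σ) * v j) := by
  have h : driftD σ τ v j * (σ * v (j + 1) + (1 - σ) * v j)
      - 1 / (4 * τ) * (driftEnergy σ v (j + 1) - driftEnergy σ v j)
      = 1 / (4 * τ) * (σ * (2 * σ - 1) * (v (j + 1) - 2 * v j + v (j - 1)) ^ 2) := by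
    simp only [driftD, driftEnergy, Nat.add_sub_cancel]
    field_simp
    ring
  have : 0 ≤ 1 / (4 * τ) * (σ * (2 * σ - 1) * (v (j + 1) - 2 * v j + v (j - 1)) ^ 2) := by
    have : 0 ≤ 2 * σ - 1 := by linarith
    positivity
  linarith

theorem sq_le_driftEnergy {σ : ℝ} (hσ0 : 1 / 2 < σ) (hσ1 : σ ≤ 1) (v : ℕ → ℝ) (n : ℕ) :
    v n ^ 2 ≤ driftEnergy σ v n := by
  unfold driftEnergy
  generalize v n = a
  generalize v (n - 1) = b
  have h1 : 0 < σ * (2 * σ - 1) := mul_pos (by linarith) (by linarith)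
  have h2 : 0 ≤ (σ * (2 * σ - 1)) * (((2 * σ + 1) * a ^ 2 - (2 * σ - 1) * b ^ 2
      + (2 * σ ^ 2 + σ - 1) * (a - b) ^ 2) - a ^ 2) := by
    have : (σ * (2 * σ - 1)) * (((2 * σ + 1) * a ^ 2 - (2 * σ - 1) * b ^ 2
      + (2 * σ ^ 2 + σ - 1) * (a - b) ^ 2) - a ^ 2)
      = (σ * (2 * σ - 1) * b - (2 * σ ^ 2 + σ - 1) * a) ^ 2
        + (2 * σ - 1) * (1 - σ) * a ^ 2 := by ring
    rw [this]
    have : 0 ≤ (2 * σ - 1) * (1 - σ) := mul_nonneg (by linarith) (by linarith)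
    positivity
  linarith [nonneg_of_mul_nonneg_right h2 h1]

open Finset in
theorem fracD_eq {α σ τ : ℝ} {v : ℕ → ℝ} (hv : v 0 = 0) (j : ℕ) :
    fracD α σ τ v j = τ ^ (-α) / Real.Gamma (2 - α)
      * (∑ s ∈ range (j + 1), kernelC α σ (j - s) * (v (s + 1) - v s) - bC α σ (j + 1) * v 1) := by
  unfold fracD
  rw [sum_range_succ' _ j, sum_range_succ' _ j, Nat.sub_zero, cC_self, hv]
  have : ∑ s ∈ range j, cC α σ j (j - (s + 1)) * (v (s + 1 + 1) - v (s + 1))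
      = ∑ s ∈ range j, kernelC α σ (j - (s + 1)) * (v (s + 1 + 1) - v (s + 1)) :=
    sum_congr rfl fun s hs => by rw [cC_eq_kernelC_of_lt (by have := mem_range.1 hs; omega)]
  rw [this]
  simp only [zero_add]
  ring

theorem rpow_div_Gamma_nonneg {α τ : ℝ} (hα : 0 < α ∧ α < 1) (hτ : 0 < τ) :
    0 ≤ τ ^ (-α) / Real.Gamma (2 - α) :=
  div_nonneg (by positivity) (Real.Gamma_pos_of_pos (by linarith [hα.2])).le

open Finset in
theorem half_sum_kernelC_sq_le {α σ : ℝ} (hα : 0 < α ∧ α < 1) (hσ : σ = 1 - α / 2)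
    (v : ℕ → ℝ) (j : ℕ) :
    1 / 2 * ∑ s ∈ range (j + 1), kernelC α σ (j - s) * (v (s + 1) ^ 2 - v s ^ 2)
      ≤ (∑ s ∈ range (j + 1), kernelC α σ (j - s) * (v (s + 1) - v s))
        * (σ * v (j + 1) + (1 - σ) * v j) := by
  refine half_sum_kernel_sq_le (fun s => kernelC α σ (j - s)) v σ (by linarith [hα.2])
    (by linarith [hα.1]) j (fun s _ => kernelC_pos hα hσ _)
    (fun s _ => kernelC_antitone hα hσ (by omega)) ?_
  rintro s rfl
  simpa using mul_kernelC_one_le hα hσ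

open Finset in
/-- Energy estimate for a scalar sequence vanishing initially. -/
theorem sq_div_le_sum_energy {α σ τ : ℝ} (hα : 0 < α ∧ α < 1) (hσ : σ = 1 - α / 2) (hτ : 0 < τ)
    {v : ℕ → ℝ} (hv : v 0 = 0) (n : ℕ) :
    1 / (4 * τ) * v n ^ 2 ≤ ∑ j ∈ range n,
      (driftD σ τ v j + fracD α σ τ v j
        + τ ^ (-α) / Real.Gamma (2 - α) * bC α σ (j + 1) * v 1)
          * (σ * v (j + 1) + (1 - σ) * v j) := by
  have hκ := rpow_div_Gamma_nonneg hα hτ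
  have h1 : 1 / (4 * τ) * v n ^ 2 ≤ ∑ j ∈ range n,
      1 / (4 * τ) * (driftEnergy σ v (j + 1) - driftEnergy σ v j) := by
    rw [← mul_sum, sum_range_sub, show driftEnergy σ v 0 = 0 by simp [driftEnergy, hv], sub_zero]
    gcongr
    exact sq_le_driftEnergy (by linarith [hα.2]) (by linarith [hα.1]) v n
  have h2 : 0 ≤ ∑ j ∈ range n, τ ^ (-α) / Real.Gamma (2 - α)
      * (1 / 2 * ∑ s ∈ range (j + 1), kernelC α σ (j - s) * (v (s + 1) ^ 2 - v s ^ 2)) := by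
    rw [← mul_sum, ← mul_sum,
      sum_convolution_diff (kernelC α σ) (fun s => v s ^ 2) (by simp [hv])]
    have : 0 ≤ ∑ s ∈ range n, kernelC α σ (n - 1 - s) * v (s + 1) ^ 2 :=
      sum_nonneg fun s _ => mul_nonneg (kernelC_pos hα hσ _).le (sq_nonneg _)
    positivity
  calc _ ≤ ∑ j ∈ range n, (1 / (4 * τ) * (driftEnergy σ v (j + 1) - driftEnergy σ v j)
        + τ ^ (-α) / Real.Gamma (2 - α)
          * (1 / 2 * ∑ s ∈ range (j + 1), kernelC α σ (j - s) * (v (s + 1) ^ 2 - v s ^ 2))) := by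
        rw [sum_add_distrib]
        linarith
    _ ≤ _ := by
        apply sum_le_sum
        intro j _
        have e1 := driftEnergy_sub_le (σ := σ) (by linarith [hα.2]) hτ v j
        have e2 := mul_le_mul_of_nonneg_left (half_sum_kernelC_sq_le hα hσ v j) hκ
        rw [fracD_eq hv]
        linarith

theorem sq_div_le_energy_first {α σ τ : ℝ} (hα : 0 < α ∧ α < 1) (hσ : σ = 1 - α / 2)
    (hτ : 0 < τ) {v : ℕ → ℝ} (hv : v 0 = 0) :
    1 / (4 * τ) * v 1 ^ 2 ≤ (driftD σ τ v 0 + fracD α σ τ v 0) * (σ * v 1 + (1 - σ) * v 0) := by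
  have hκ := rpow_div_Gamma_nonneg hα hτ
  have hs : 0 < σ := by linarith [hα.2]
  have e1 := driftEnergy_sub_le (σ := σ) (by linarith [hα.2]) hτ v 0
  have e2 := sq_le_driftEnergy (σ := σ) (by linarith [hα.2]) (by linarith [hα.1]) v 1
  rw [zero_add, show driftEnergy σ v 0 = 0 by simp [driftEnergy, hv], sub_zero] at e1
  have e3 : 1 / (4 * τ) * v 1 ^ 2 ≤ 1 / (4 * τ) * driftEnergy σ v 1 := by gcongr
  have e4 : fracD α σ τ v 0 * (σ * v 1 + (1 - σ) * v 0)
      = τ ^ (-α) / Real.Gamma (2 - α) * (σ ^ (1 - α) * σ * v 1 ^ 2) := by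
    simp [fracD, cC, aC, hv]
    ring
  have e5 : 0 ≤ τ ^ (-α) / Real.Gamma (2 - α) * (σ ^ (1 - α) * σ * v 1 ^ 2) := by positivity
  linarith

open Finset in
theorem sqrt_sum_sq_avg_le {ι : Type*} (S : Finset ι) (f g : ι → ℝ) {σ m : ℝ} (hσ0 : 0 ≤ σ)
    (hσ1 : σ ≤ 1) (hf : √(∑ p ∈ S, f p ^ 2) ≤ m) (hg : √(∑ p ∈ S, g p ^ 2) ≤ m) :
    √(∑ p ∈ S, (σ * f p + (1 - σ) * g p) ^ 2) ≤ m := by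
  have hm : 0 ≤ m := (Real.sqrt_nonneg _).trans hf
  rw [Real.sqrt_le_left hm] at *
  calc ∑ p ∈ S, (σ * f p + (1 - σ) * g p) ^ 2
      ≤ ∑ p ∈ S, (σ * f p ^ 2 + (1 - σ) * g p ^ 2) := by
        apply sum_le_sum
        intro p _
        nlinarith [mul_nonneg (mul_nonneg hσ0 (by linarith : 0 ≤ 1 - σ)) (sq_nonneg (f p - g p))]
    _ = σ * ∑ p ∈ S, f p ^ 2 + (1 - σ) * ∑ p ∈ S, g p ^ 2 := by
        rw [sum_add_distrib, mul_sum, mul_sum]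
    _ ≤ m ^ 2 := by nlinarith

open Finset in
theorem sum_mul_le_of_sqrt_le {ι : Type*} (S : Finset ι) (f g : ι → ℝ) {a b : ℝ}
    (hf : √(∑ p ∈ S, f p ^ 2) ≤ a) (hg : √(∑ p ∈ S, g p ^ 2) ≤ b) :
    ∑ p ∈ S, f p * g p ≤ a * b :=
  (Real.sum_mul_le_sqrt_mul_sqrt S f g).trans
    (mul_le_mul hf hg (Real.sqrt_nonneg _) ((Real.sqrt_nonneg _).trans hf))

theorem correction_le {α σ T τ : ℝ} (hα : 0 < α ∧ α < 1) (hσ : σ = 1 - α / 2) (hT : 0 < T)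
    {M j : ℕ} (hj : j < M) (hτ : τ = T / M) :
    τ * (τ ^ (-α) / Real.Gamma (2 - α) * bC α σ (j + 1))
      ≤ 3 * T ^ (1 - α) / Real.Gamma (2 - α) := by
  have hM : (0 : ℝ) < M := by exact_mod_cast (by omega : 0 < M)
  have hτ0 : 0 < τ := by rw [hτ]; positivity
  have hG : 0 < Real.Gamma (2 - α) := Real.Gamma_pos_of_pos (by linarith [hα.2])
  have hp : 0 ≤ 1 - α := by linarith [hα.2]
  have hjM : (j : ℝ) + 1 ≤ M := by exact_mod_cast hj
  have hb : bC α σ (j + 1) ≤ 3 * (M : ℝ) ^ (1 - α) :=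
    (bC_succ_le hα hσ j).trans (by gcongr)
  have e : τ * τ ^ (-α) = τ ^ (1 - α) := by
    rw [sub_eq_add_neg, Real.rpow_add hτ0, Real.rpow_one]
  have e2 : τ ^ (1 - α) * (M : ℝ) ^ (1 - α) = T ^ (1 - α) := by
    rw [← Real.mul_rpow hτ0.le hM.le, hτ, div_mul_cancel₀ _ hM.ne']
  calc τ * (τ ^ (-α) / Real.Gamma (2 - α) * bC α σ (j + 1))
      = τ ^ (1 - α) * bC α σ (j + 1) / Real.Gamma (2 - α) := by rw [← e]; ring
    _ ≤ τ ^ (1 - α) * (3 * (M : ℝ) ^ (1 - α)) / Real.Gamma (2 - α) := by gcongr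
    _ = _ := by rw [← e2]; ring

open Finset in
/-- Stability in the `ℓ²` norm for a scheme with a dissipative spatial operator. -/
theorem sqrt_sum_sq_le_of_dissipative {ι : Type*} (S : Finset ι) (v R L : ℕ → ι → ℝ)
    {α σ T τ ρ : ℝ} {M : ℕ} (hα : 0 < α ∧ α < 1) (hσ : σ = 1 - α / 2) (hT : 0 < T) (hM : 1 ≤ M)
    (hτ : τ = T / M) (hv : ∀ p ∈ S, v 0 p = 0)
    (heq : ∀ j < M, ∀ p ∈ S, driftD σ τ (fun n => v n p) j + fracD α σ τ (fun n => v n p) j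
      = L j p + R j p)
    (hL : ∀ j < M, ∑ p ∈ S, L j p * (σ * v (j + 1) p + (1 - σ) * v j p) ≤ 0)
    (hR : ∀ j < M, √(∑ p ∈ S, R j p ^ 2) ≤ ρ) {n : ℕ} (hn : n ≤ M) :
    √(∑ p ∈ S, v n p ^ 2)
      ≤ 4 * T * (1 + 4 * (3 * T ^ (1 - α) / Real.Gamma (2 - α))) * ρ := by
  have hM0 : (0 : ℝ) < M := by exact_mod_cast hM
  have hτ0 : 0 < τ := by rw [hτ]; positivity
  have hτM : τ * M = T := by rw [hτ, div_mul_cancel₀ _ hM0.ne']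
  have hG : 0 < Real.Gamma (2 - α) := Real.Gamma_pos_of_pos (by linarith [hα.2])
  have hσ0 : 0 ≤ σ := by linarith [hα.2]
  have hσ1 : σ ≤ 1 := by linarith [hα.1]
  have hρ : 0 ≤ ρ := (Real.sqrt_nonneg _).trans (hR 0 hM)
  set B := 3 * T ^ (1 - α) / Real.Gamma (2 - α)
  have hB0 : 0 ≤ B := by positivity
  let N : ℕ → ℝ := fun n => √(∑ p ∈ S, v n p ^ 2)
  have hN0 (n : ℕ) : 0 ≤ N n := Real.sqrt_nonneg _
  have hNsq (n : ℕ) : ∑ p ∈ S, v n p ^ 2 = N n ^ 2 :=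
    (Real.sq_sqrt (sum_nonneg fun _ _ => sq_nonneg _)).symm
  have hfirst : N 1 ≤ 4 * τ * ρ := by
    have hzero : N 0 = 0 := by
      have : ∑ p ∈ S, v 0 p ^ 2 = 0 := sum_eq_zero fun p hp => by rw [hv p hp]; ring
      simp [N, this]
    have hw := sqrt_sum_sq_avg_le S (v 1) (v 0) hσ0 hσ1 le_rfl (hzero.trans_le (hN0 1))
    have hRw := sum_mul_le_of_sqrt_le S (R 0) _ (hR 0 hM) hw
    have h : 1 / (4 * τ) * N 1 ^ 2 ≤ ρ * N 1 := by
      calc 1 / (4 * τ) * N 1 ^ 2 = ∑ p ∈ S, 1 / (4 * τ) * v 1 p ^ 2 := by rw [← hNsq, mul_sum]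
        _ ≤ ∑ p ∈ S, (L 0 p + R 0 p) * (σ * v 1 p + (1 - σ) * v 0 p) := by
            apply sum_le_sum
            intro p hp
            rw [← heq 0 hM p hp]
            exact sq_div_le_energy_first hα hσ hτ0 (v := fun n => v n p) (hv p hp)
        _ = ∑ p ∈ S, L 0 p * (σ * v 1 p + (1 - σ) * v 0 p)
            + ∑ p ∈ S, R 0 p * (σ * v 1 p + (1 - σ) * v 0 p) := by
            rw [← sum_add_distrib]
            exact sum_congr rfl fun p _ => by ring
        _ ≤ _ := by linarith [hL 0 hM]
    rcases (hN0 1).eq_or_lt with h0 | h0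
    · rw [← h0]; positivity
    · rw [one_div_mul_eq_div, div_le_iff₀ (by positivity)] at h
      nlinarith
  obtain ⟨n₀, hn₀, hmax⟩ := exists_max_image (range (M + 1)) N ⟨0, by simp⟩
  have hn₀M : n₀ ≤ M := by have := mem_range.1 hn₀; omega
  have hmax (k : ℕ) (hk : k ≤ M) : N k ≤ N n₀ := hmax k (mem_range.2 (by omega))
  suffices h : N n₀ ≤ 4 * T * (1 + 4 * B) * ρ from (hmax n hn).trans h
  have hterm (j : ℕ) (hj : j < M) :
      ∑ p ∈ S, (driftD σ τ (fun n => v n p) j + fracD α σ τ (fun n => v n p) j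
        + τ ^ (-α) / Real.Gamma (2 - α) * bC α σ (j + 1) * v 1 p)
          * (σ * v (j + 1) p + (1 - σ) * v j p) ≤ (1 + 4 * B) * ρ * N n₀ := by
    set b := τ ^ (-α) / Real.Gamma (2 - α) * bC α σ (j + 1)
    have hb0 : 0 ≤ b := mul_nonneg (rpow_div_Gamma_nonneg hα hτ0) (bC_succ_nonneg hα hσ j)
    have hbτ : τ * b ≤ B := correction_le hα hσ hT hj hτ
    have hw := sqrt_sum_sq_avg_le S (v (j + 1)) (v j) hσ0 hσ1 (hmax (j + 1) hj) (hmax j hj.le)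
    have hRw := sum_mul_le_of_sqrt_le S (R j) _ (hR j hj) hw
    have hvw := sum_mul_le_of_sqrt_le S (v 1) _ hfirst hw
    calc _ = ∑ p ∈ S, L j p * (σ * v (j + 1) p + (1 - σ) * v j p)
            + ∑ p ∈ S, R j p * (σ * v (j + 1) p + (1 - σ) * v j p)
            + b * ∑ p ∈ S, v 1 p * (σ * v (j + 1) p + (1 - σ) * v j p) := by
          rw [mul_sum, ← sum_add_distrib, ← sum_add_distrib]
          exact sum_congr rfl fun p hp => by rw [heq j hj p hp]; ring
      _ ≤ 0 + ρ * N n₀ + b * (4 * τ * ρ * N n₀) :=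
          add_le_add (add_le_add (hL j hj) hRw) (mul_le_mul_of_nonneg_left hvw hb0)
      _ = ρ * N n₀ + 4 * (τ * b) * (ρ * N n₀) := by ring
      _ ≤ ρ * N n₀ + 4 * B * (ρ * N n₀) := by
          have := mul_nonneg hρ (hN0 n₀)
          gcongr
      _ = _ := by ring
  have hfinal : 1 / (4 * τ) * N n₀ ^ 2 ≤ M * ((1 + 4 * B) * ρ * N n₀) := by
    calc 1 / (4 * τ) * N n₀ ^ 2 = ∑ p ∈ S, 1 / (4 * τ) * v n₀ p ^ 2 := by rw [← hNsq, mul_sum]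
      _ ≤ _ := sum_le_sum fun p hp =>
          sq_div_le_sum_energy hα hσ hτ0 (v := fun n => v n p) (hv p hp) n₀
      _ ≤ ∑ j ∈ range n₀, (1 + 4 * B) * ρ * N n₀ := by
          rw [sum_comm]
          exact sum_le_sum fun j hj => hterm j (by have := mem_range.1 hj; omega)
      _ ≤ _ := by
          rw [sum_const, card_range, nsmul_eq_mul]
          have := hN0 n₀
          gcongr
  rcases (hN0 n₀).eq_or_lt with h0 | h0
  · rw [← h0]; positivity
  · rw [one_div_mul_eq_div, div_le_iff₀ (by positivity)] at hfinal
    rw [← hτM]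
    nlinarith

open Finset in
theorem sum_flux_mul_eq (D V : ℕ → ℝ) (hV : V 0 = 0) (n : ℕ) :
    ∑ i ∈ Icc 1 n, (D i * (V (i + 1) - V i) - D (i - 1) * (V i - V (i - 1))) * V i
      = D n * (V (n + 1) - V n) * V (n + 1)
        - ∑ i ∈ range (n + 1), D i * (V (i + 1) - V i) ^ 2 := by
  induction n with
  | zero =>
    simp [hV]
    ring
  | succ n ih =>
    rw [sum_Icc_succ_top (by omega), ih, sum_range_succ _ (n + 1), Nat.add_sub_cancel]
    ring

open Finset in
theorem sum_flux_mul_nonpos {D V : ℕ → ℝ} {N : ℕ} (hN : 1 ≤ N) (hD : ∀ i < N, 0 ≤ D i)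
    (hV0 : V 0 = 0) (hVN : V N = 0) :
    ∑ i ∈ Icc 1 (N - 1), (D i * (V (i + 1) - V i) - D (i - 1) * (V i - V (i - 1))) * V i ≤ 0 := by
  rw [sum_flux_mul_eq D V hV0, Nat.sub_add_cancel hN, hVN, mul_zero, zero_sub, neg_nonpos]
  exact sum_nonneg fun i hi => mul_nonneg (hD i (mem_range.1 hi)) (sq_nonneg _)

theorem lam2D_avg (d k q : ℝ → ℝ → ℝ → ℝ) (hx hy t σ : ℝ) (U V : ℕ → ℕ → ℝ) (i l : ℕ) :
    σ * lam2D d k q hx hy t U i l + (1 - σ) * lam2D d k q hx hy t V i l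
      = lam2D d k q hx hy t (fun i l => σ * U i l + (1 - σ) * V i l) i l := by
  simp only [lam2D]
  ring

open Finset in
theorem sum_lam2D_mul_nonpos {d k q : ℝ → ℝ → ℝ → ℝ} {hx hy t : ℝ} {Nx Ny : ℕ} {V : ℕ → ℕ → ℝ}
    (hNx : 1 ≤ Nx) (hNy : 1 ≤ Ny)
    (hd : ∀ i l : ℕ, i < Nx → l ≤ Ny → 0 ≤ d (i * hx + hx / 2) (l * hy) t)
    (hk : ∀ i l : ℕ, i ≤ Nx → l < Ny → 0 ≤ k (i * hx) (l * hy + hy / 2) t)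
    (hq : ∀ i l : ℕ, i ≤ Nx → l ≤ Ny → 0 ≤ q (i * hx) (l * hy) t)
    (hVx : ∀ l, V 0 l = 0 ∧ V Nx l = 0) (hVy : ∀ i, V i 0 = 0 ∧ V i Ny = 0) :
    ∑ i ∈ Icc 1 (Nx - 1), ∑ l ∈ Icc 1 (Ny - 1), lam2D d k q hx hy t V i l * V i l ≤ 0 := by
  have hpred (h : ℝ) {i : ℕ} (hi : 1 ≤ i) : (i : ℝ) * h - h / 2 = ((i - 1 : ℕ) : ℝ) * h + h / 2 := by
    rw [Nat.cast_sub hi]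
    push_cast
    ring
  have hterm : ∀ i ∈ Icc 1 (Nx - 1), ∀ l ∈ Icc 1 (Ny - 1), lam2D d k q hx hy t V i l * V i l
      ≤ 1 / hx ^ 2 * ((d (i * hx + hx / 2) (l * hy) t * (V (i + 1) l - V i l)
          - d ((i - 1 : ℕ) * hx + hx / 2) (l * hy) t * (V i l - V (i - 1) l)) * V i l)
        + 1 / hy ^ 2 * ((k (i * hx) (l * hy + hy / 2) t * (V i (l + 1) - V i l)
          - k (i * hx) ((l - 1 : ℕ) * hy + hy / 2) t * (V i l - V i (l - 1))) * V i l) := by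
    intro i hi l hl
    rw [mem_Icc] at hi hl
    have h := mul_nonneg (hq i l (by omega) (by omega)) (sq_nonneg (V i l))
    simp only [lam2D, hpred hx hi.1, hpred hy hl.1]
    linarith
  refine (sum_le_sum fun i hi => sum_le_sum (hterm i hi)).trans ?_
  simp only [sum_add_distrib, ← mul_sum]
  refine add_nonpos (mul_nonpos_of_nonneg_of_nonpos (by positivity) ?_)
    (mul_nonpos_of_nonneg_of_nonpos (by positivity) ?_)
  · rw [sum_comm]
    refine sum_nonpos fun l hl => ?_
    rw [mem_Icc] at hl
    exact sum_flux_mul_nonpos (D := fun i : ℕ => d (i * hx + hx / 2) (l * hy) t)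
      (V := fun i => V i l) hNx (fun i hi => hd i l hi (by omega)) (hVx l).1 (hVx l).2
  · refine sum_nonpos fun i hi => ?_
    rw [mem_Icc] at hi
    exact sum_flux_mul_nonpos (D := fun l : ℕ => k (i * hx) (l * hy + hy / 2) t)
      (V := fun l => V i l) hNy (fun l hl => hk i l (by omega) hl) (hVy i).1 (hVy i).2

/-- Convergence of the implicit L2-1_σ scheme for the 2D time fractional
reaction-diffusion equation: if the error grid function satisfies the error
equation with residuals of size `K(τ² + hx² + hy²)`, then the error is
`O(τ² + hx² + hy²)` in the discrete `L₂` norm, with a constant independent of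
the grids. -/
theorem convergence_2D (α : ℝ) (hα : 0 < α ∧ α < 1) (σ : ℝ)
    (hσ : σ = 1 - α / 2) (T : ℝ) (hT : 0 < T) (K : ℝ) (hK : 0 < K) :
    ∃ C₃ > 0, ∀ (Lx Ly : ℝ) (Nx Ny M : ℕ) (hx hy τ : ℝ)
      (d k q : ℝ → ℝ → ℝ → ℝ) (C₃' C₄ : ℝ) (ξ : ℕ → ℕ → ℕ → ℝ)
      (R : ℕ → ℕ → ℕ → ℝ),
      0 < Lx → 0 < Ly → 2 ≤ Nx → 2 ≤ Ny → 1 ≤ M →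
      hx = Lx / Nx → hy = Ly / Ny → τ = T / M → 0 < C₃' → 0 < C₄ →
      (∀ x ∈ Set.Icc 0 Lx, ∀ y ∈ Set.Icc 0 Ly, ∀ t ∈ Set.Icc 0 T, C₃' ≤ d x y t) →
      (∀ x ∈ Set.Icc 0 Lx, ∀ y ∈ Set.Icc 0 Ly, ∀ t ∈ Set.Icc 0 T, C₄ ≤ k x y t) →
      (∀ x ∈ Set.Icc 0 Lx, ∀ y ∈ Set.Icc 0 Ly, ∀ t ∈ Set.Icc 0 T, 0 ≤ q x y t) →
      (∀ i l, i ≤ Nx → l ≤ Ny → ξ 0 i l = 0) →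
      (∀ j, j ≤ M → ∀ l, ξ j 0 l = 0 ∧ ξ j Nx l = 0) →
      (∀ j, j ≤ M → ∀ i, ξ j i 0 = 0 ∧ ξ j i Ny = 0) →
      (∀ j < M, ∀ i, 1 ≤ i → i ≤ Nx - 1 → ∀ l, 1 ≤ l → l ≤ Ny - 1 →
        driftD σ τ (fun m => ξ m i l) j + fracD α σ τ (fun m => ξ m i l) j
          = σ * lam2D d k q hx hy (((j : ℝ) + σ) * τ) (ξ (j + 1)) i l
            + (1 - σ) * lam2D d k q hx hy (((j : ℝ) + σ) * τ) (ξ j) i l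
            + R j i l) →
      (∀ j < M, Real.sqrt (nrm2D hx hy Nx Ny (R j)) ≤ K * (τ ^ 2 + hx ^ 2 + hy ^ 2)) →
      ∀ j, j ≤ M →
        Real.sqrt (nrm2D hx hy Nx Ny (ξ j)) ≤ C₃ * (τ ^ 2 + hx ^ 2 + hy ^ 2) := by
  have hG : 0 < Real.Gamma (2 - α) := Real.Gamma_pos_of_pos (by linarith [hα.2])
  refine ⟨4 * T * (1 + 4 * (3 * T ^ (1 - α) / Real.Gamma (2 - α))) * K, by positivity, ?_⟩
  intro Lx Ly Nx Ny M hx hy τ d k q C₃' C₄ ξ R hLx hLy hNx hNy hM hhx hhy hτ hC₃ hC₄ hd hk hq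
    hξ0 hξx hξy heq hR n hn
  have hNx0 : (0 : ℝ) < Nx := by exact_mod_cast (by omega : 0 < Nx)
  have hNy0 : (0 : ℝ) < Ny := by exact_mod_cast (by omega : 0 < Ny)
  have hM0 : (0 : ℝ) < M := by exact_mod_cast hM
  have hx0 : 0 < hx := by rw [hhx]; positivity
  have hy0 : 0 < hy := by rw [hhy]; positivity
  have hτ0 : 0 < τ := by rw [hτ]; positivity
  have hxL : Nx * hx = Lx := by rw [hhx]; field_simp
  have hyL : Ny * hy = Ly := by rw [hhy]; field_simp
  have hτT : M * τ = T := by rw [hτ]; field_simp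
  have node {h L : ℝ} {N i : ℕ} (hh : 0 < h) (hL : N * h = L) (hi : i ≤ N) :
      (i : ℝ) * h ∈ Set.Icc 0 L := by
    have : (i : ℝ) ≤ N := by exact_mod_cast hi
    exact ⟨by positivity, by rw [← hL]; gcongr⟩
  have midnode {h L : ℝ} {N i : ℕ} (hh : 0 < h) (hL : N * h = L) (hi : i < N) :
      (i : ℝ) * h + h / 2 ∈ Set.Icc 0 L := by
    have : (i : ℝ) + 1 ≤ N := by exact_mod_cast hi
    exact ⟨by positivity, by rw [← hL]; nlinarith⟩
  have time {j : ℕ} (hj : j < M) : ((j : ℝ) + σ) * τ ∈ Set.Icc 0 T := by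
    have : (j : ℝ) + 1 ≤ M := by exact_mod_cast hj
    have hσ0 : 0 ≤ σ := by linarith [hα.2]
    have hσ1 : σ ≤ 1 := by linarith [hα.1]
    exact ⟨by positivity, by rw [← hτT]; gcongr; linarith⟩
  let S := Finset.Icc 1 (Nx - 1) ×ˢ Finset.Icc 1 (Ny - 1)
  have hS {p : ℕ × ℕ} (hp : p ∈ S) : (1 ≤ p.1 ∧ p.1 ≤ Nx - 1) ∧ 1 ≤ p.2 ∧ p.2 ≤ Ny - 1 := by
    simpa [S] using hp
  have hnrm (V : ℕ → ℕ → ℝ) :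
      √(nrm2D hx hy Nx Ny V) = √(hx * hy) * √(∑ p ∈ S, V p.1 p.2 ^ 2) := by
    rw [nrm2D, Real.sqrt_mul (by positivity), Finset.sum_product]
  have hs : 0 < √(hx * hy) := Real.sqrt_pos.2 (by positivity)
  have h := sqrt_sum_sq_le_of_dissipative S (fun j p => ξ j p.1 p.2) (fun j p => R j p.1 p.2)
    (fun j p => lam2D d k q hx hy (((j : ℝ) + σ) * τ)
      (fun i l => σ * ξ (j + 1) i l + (1 - σ) * ξ j i l) p.1 p.2)
    (ρ := K * (τ ^ 2 + hx ^ 2 + hy ^ 2) / √(hx * hy)) hα hσ hT hM hτ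
    (fun p hp => by have := hS hp; exact hξ0 _ _ (by omega) (by omega))
    (fun j hj p hp => by
      have := hS hp
      rw [heq j hj p.1 this.1.1 this.1.2 p.2 this.2.1 this.2.2, lam2D_avg])
    (fun j hj => by
      rw [Finset.sum_product]
      refine sum_lam2D_mul_nonpos (by omega) (by omega)
        (fun i l hi hl => hC₃.le.trans
          (hd _ (midnode hx0 hxL hi) _ (node hy0 hyL hl) _ (time hj)))
        (fun i l hi hl => hC₄.le.trans
          (hk _ (node hx0 hxL hi) _ (midnode hy0 hyL hl) _ (time hj)))
        (fun i l hi hl => hq _ (node hx0 hxL hi) _ (node hy0 hyL hl) _ (time hj)) ?_ ?_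
      · intro l
        simp [hξx j hj.le l, hξx (j + 1) hj l]
      · intro i
        simp [hξy j hj.le i, hξy (j + 1) hj i])
    (fun j hj => by
      rw [le_div_iff₀ hs, mul_comm, ← hnrm]
      exact hR j hj) hn
  rw [hnrm]
  refine (mul_le_mul_of_nonneg_left h hs.le).trans_eq ?_
  field_simp
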